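/- arXiv:2402.04969 — 2 statements merged into one kernel-verified Lean document; each statement's English description precedes it below -/
import Mathlib

section
/- For every real α with 0 < α < 1 and every real t > 0, the function t ↦ E_α(−t^α) is differentiable at t and its derivative equals −t^{α−1} E_{α,α}(−t^α). -/
/-- The two-parameter Mittag-Leffler function `E_{α,β}(x) = ∑ x ^ k / Γ(α k + β)`
for real `x`. The classical Mittag-Leffler function is `E_α = E_{α,1}`. -/
noncomputable def mittagLeffler (α β : ℝ) (x : ℝ) : ℝ :=
  ∑' k : ℕ, x ^ k / Real.Gamma (α * k + β)

open MeasureTheory Set Filter in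
theorem Real.rpow_mul_exp_neg_le_Gamma {R s : ℝ} (hR : 0 < R) (hs : 1 ≤ s) :
    R ^ (s - 1) * Real.exp (-R) ≤ Real.Gamma s := by
  have hint := Real.GammaIntegral_convergent (zero_lt_one.trans_le hs)
  have hsub : Ioi R ⊆ Ioi (0 : ℝ) := Ioi_subset_Ioi hR.le
  calc R ^ (s - 1) * Real.exp (-R) = ∫ x in Ioi R, Real.exp (-x) * R ^ (s - 1) := by
        rw [integral_mul_const, integral_exp_neg_Ioi, mul_comm]
    _ ≤ ∫ x in Ioi R, Real.exp (-x) * x ^ (s - 1) := by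
        refine setIntegral_mono_on ((integrableOn_exp_neg_Ioi R).mul_const _)
          (hint.mono_set hsub) measurableSet_Ioi fun x hx => ?_
        have hx' : R ≤ x := le_of_lt hx
        have hs' : 0 ≤ s - 1 := by linarith
        gcongr
    _ ≤ ∫ x in Ioi 0, Real.exp (-x) * x ^ (s - 1) := by
        refine setIntegral_mono_set hint ?_ hsub.eventuallyLE
        filter_upwards [ae_restrict_mem measurableSet_Ioi] with x hx
        have hx' : (0 : ℝ) < x := hx
        simp only [Pi.zero_apply]
        positivity
    _ = Real.Gamma s := (Real.Gamma_eq_integral (zero_lt_one.trans_le hs)).symm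

open Filter in
theorem summable_pow_div_Gamma {α : ℝ} (hα : 0 < α) (β x : ℝ) :
    Summable fun k : ℕ => x ^ k / Real.Gamma (α * k + β) := by
  set M : ℝ := 2 * (|x| + 1) with hM
  have hx : 0 ≤ |x| := abs_nonneg x
  have hM0 : 0 < M := by positivity
  set R : ℝ := M ^ α⁻¹ with hR
  have hR0 : 0 < R := by positivity
  have hRα : R ^ α = M := by rw [hR, ← Real.rpow_mul hM0.le, inv_mul_cancel₀ hα.ne', Real.rpow_one]
  have hgeo : Summable fun k : ℕ => (R ^ (β - 1) * Real.exp (-R))⁻¹ * (|x| / M) ^ k := by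
    refine (summable_geometric_of_lt_one (by positivity) ?_).mul_left _
    rw [div_lt_one hM0]
    linarith
  have hlim : Tendsto (fun k : ℕ => α * (k : ℝ) + β) atTop atTop :=
    tendsto_atTop_add_const_right _ _ (tendsto_natCast_atTop_atTop.const_mul_atTop hα)
  refine summable_of_isBigO_nat hgeo (Asymptotics.IsBigO.of_bound 1 ?_)
  filter_upwards [hlim.eventually_ge_atTop 1] with k hk
  have hG := Real.rpow_mul_exp_neg_le_Gamma hR0 hk
  have hpow : R ^ (α * k + β - 1) = M ^ k * R ^ (β - 1) := by
    rw [add_sub_assoc, Real.rpow_add hR0, Real.rpow_mul hR0.le, hRα, Real.rpow_natCast]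
  rw [hpow] at hG
  have hGpos : 0 < Real.Gamma (α * k + β) := Real.Gamma_pos_of_pos (by linarith)
  rw [one_mul, norm_div, norm_pow, Real.norm_eq_abs, Real.norm_of_nonneg hGpos.le,
    Real.norm_of_nonneg (by positivity)]
  calc |x| ^ k / Real.Gamma (α * k + β)
      ≤ |x| ^ k / (M ^ k * R ^ (β - 1) * Real.exp (-R)) := by gcongr
    _ = (R ^ (β - 1) * Real.exp (-R))⁻¹ * (|x| / M) ^ k := by
        rw [div_pow]
        field_simp

theorem natCast_succ_mul_pow_div_Gamma {α : ℝ} (hα : 0 < α) (x : ℝ) (k : ℕ) :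
    ((k + 1 : ℕ) : ℝ) * x ^ (k + 1 - 1) / Real.Gamma (α * (k + 1 : ℕ) + 1) =
      α⁻¹ * (x ^ k / Real.Gamma (α * k + α)) := by
  have hk : (0 : ℝ) < (k : ℝ) + 1 := by positivity
  have hG : 0 < Real.Gamma (α * k + α) := Real.Gamma_pos_of_pos (by positivity)
  rw [Real.Gamma_add_one (by positivity), Nat.add_sub_cancel]
  push_cast
  rw [mul_add, mul_one]
  field_simp

theorem hasDerivAt_mittagLeffler_one {α : ℝ} (hα : 0 < α) (x : ℝ) :
    HasDerivAt (mittagLeffler α 1) (α⁻¹ * mittagLeffler α α x) x := by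
  have hsum (y : ℝ) :
      Summable fun k : ℕ => (k : ℝ) * y ^ (k - 1) / Real.Gamma (α * k + 1) := by
    rw [← summable_nat_add_iff 1]
    simp_rw [natCast_succ_mul_pow_div_Gamma hα]
    exact (summable_pow_div_Gamma hα α y).mul_left _
  have hx : x ∈ Metric.ball (0 : ℝ) (|x| + 1) := by simp
  have hderiv := hasDerivAt_tsum_of_isPreconnected (hsum (|x| + 1)) Metric.isOpen_ball
    (convex_ball (0 : ℝ) (|x| + 1)).isPreconnected
    (g := fun (k : ℕ) y => y ^ k / Real.Gamma (α * k + 1))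
    (g' := fun (k : ℕ) y => (k : ℝ) * y ^ (k - 1) / Real.Gamma (α * k + 1))
    (fun k y _ => (hasDerivAt_pow k y).div_const _)
    (fun k y hy => by
      have hG : 0 < Real.Gamma (α * k + 1) := Real.Gamma_pos_of_pos (by positivity)
      have hy' : |y| ≤ |x| + 1 := by simpa using (mem_ball_zero_iff.mp hy).le
      rw [norm_div, norm_mul, norm_pow, Real.norm_natCast, Real.norm_eq_abs,
        Real.norm_of_nonneg hG.le]
      gcongr)
    hx (summable_pow_div_Gamma hα 1 x) hx
  refine HasDerivAt.congr_deriv (f := mittagLeffler α 1) hderiv ?_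
  rw [(hsum x).tsum_eq_zero_add]
  simp_rw [natCast_succ_mul_pow_div_Gamma hα]
  rw [tsum_mul_left]
  simp [mittagLeffler]

/-- For every real `α` with `0 < α < 1` and every real `t > 0`, the function
`t ↦ E_α(-t^α)` is differentiable at `t` with derivative `-t^(α-1) E_{α,α}(-t^α)`. -/
theorem mittagLeffler_hasDerivAt (α : ℝ) (hα : 0 < α) (hα1 : α < 1) (t : ℝ) (ht : 0 < t) :
    HasDerivAt (fun t : ℝ => mittagLeffler α 1 (-(t ^ α)))
      (-(t ^ (α - 1) * mittagLeffler α α (-(t ^ α)))) t := by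
  have h := (hasDerivAt_mittagLeffler_one hα (-(t ^ α))).comp t
    (Real.hasDerivAt_rpow_const (p := α) (Or.inl ht.ne')).neg
  refine h.congr_deriv ?_
  field_simp
end

section
/- For every real α with 0 < α < 1 and every real x ≥ 0, the value E_{α,α}(−x) is strictly positive. -/
open MeasureTheory Set Filter Topology

/-- The scaled Beta integral over the reals. -/
theorem integral_rpow_mul_sub_rpow {a b t : ℝ} (ha : 0 < a) (hb : 0 < b) (ht : 0 < t) :
    ∫ s in (0 : ℝ)..t, s ^ (a - 1) * (t - s) ^ (b - 1) =
      t ^ (a + b - 1) * (Real.Gamma a * Real.Gamma b / Real.Gamma (a + b)) := by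
  have h := Complex.betaIntegral_scaled (a : ℂ) (b : ℂ) ht
  rw [Complex.betaIntegral_eq_Gamma_mul_div _ _ (by simpa) (by simpa)] at h
  have h2 : ∫ x in (0 : ℝ)..t, (x : ℂ) ^ ((a : ℂ) - 1) * ((t : ℂ) - x) ^ ((b : ℂ) - 1) =
      ∫ x in (0 : ℝ)..t, ((x ^ (a - 1) * (t - x) ^ (b - 1) : ℝ) : ℂ) := by
    refine intervalIntegral.integral_congr fun x hx => ?_
    rw [uIcc_of_le ht.le] at hx
    simp only [Complex.ofReal_mul]
    rw [Complex.ofReal_cpow hx.1, Complex.ofReal_cpow (sub_nonneg.2 hx.2)]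
    push_cast
    rfl
  rw [h2, intervalIntegral.integral_ofReal, ← Complex.ofReal_add, Complex.Gamma_ofReal,
    Complex.Gamma_ofReal, Complex.Gamma_ofReal, ← Complex.ofReal_one, ← Complex.ofReal_sub,
    ← Complex.ofReal_cpow ht.le] at h
  exact_mod_cast h

theorem intervalIntegrable_rpow_mul_sub_rpow {a b t : ℝ} (ha : 0 < a) (hb : 0 < b) (ht : 0 < t) :
    IntervalIntegrable (fun s => s ^ (a - 1) * (t - s) ^ (b - 1)) volume 0 t := by
  by_contra h
  have h1 := integral_rpow_mul_sub_rpow ha hb ht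
  rw [intervalIntegral.integral_undef h] at h1
  have := Real.Gamma_pos_of_pos ha
  have := Real.Gamma_pos_of_pos hb
  have := Real.Gamma_pos_of_pos (add_pos ha hb)
  have : 0 < t ^ (a + b - 1) * (Real.Gamma a * Real.Gamma b / Real.Gamma (a + b)) := by positivity
  linarith

/-- A form of Wendel's inequality for ratios of Gamma values. -/
theorem Gamma_div_Gamma_add_le {α s : ℝ} (hα : 0 < α) (hα1 : α < 1) (hs : 0 < s) :
    Real.Gamma s / Real.Gamma (s + α) ≤ (s + α) ^ (1 - α) / s := by
  have hsa : 0 < s + α := by positivity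
  have hG := Real.Gamma_pos_of_pos hsa
  have h := Real.Gamma_mul_add_mul_le_rpow_Gamma_mul_rpow_Gamma (s := s + α) (t := s + α + 1)
    hsa (by positivity) hα (sub_pos.2 hα1) (by ring)
  rw [show α * (s + α) + (1 - α) * (s + α + 1) = s + 1 by ring, Real.Gamma_add_one hs.ne',
    Real.Gamma_add_one hsa.ne', Real.mul_rpow hsa.le hG.le,
    show Real.Gamma (s + α) ^ α * ((s + α) ^ (1 - α) * Real.Gamma (s + α) ^ (1 - α)) =
      (s + α) ^ (1 - α) * (Real.Gamma (s + α) ^ α * Real.Gamma (s + α) ^ (1 - α)) by ring,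
    ← Real.rpow_add hG, add_sub_cancel, Real.rpow_one] at h
  rw [div_le_div_iff₀ hG hs]
  linarith

theorem tendsto_add_rpow_div {α : ℝ} (hα : 0 < α) (hα1 : α < 1) :
    Tendsto (fun s : ℝ => (s + α) ^ (1 - α) / s) atTop (𝓝 0) := by
  have h1 : Tendsto (fun s : ℝ => 2 * s ^ (-α)) atTop (𝓝 0) := by
    simpa using (tendsto_rpow_neg_atTop hα).const_mul 2
  refine squeeze_zero' ?_ ?_ h1
  · filter_upwards [eventually_gt_atTop 0] with s hs
    positivity
  · filter_upwards [eventually_ge_atTop 1] with s hs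
    have hs0 : 0 < s := by linarith
    rw [div_le_iff₀ hs0]
    calc (s + α) ^ (1 - α) ≤ (2 * s) ^ (1 - α) :=
          Real.rpow_le_rpow (by positivity) (by linarith) (by linarith)
      _ = 2 ^ (1 - α) * s ^ (1 - α) := Real.mul_rpow (by norm_num) hs0.le
      _ ≤ 2 ^ (1 : ℝ) * s ^ (1 - α) := by
          gcongr
          · norm_num
          · linarith
      _ = 2 * s ^ (-α) * s := by
          rw [Real.rpow_one, mul_assoc, show 1 - α = -α + 1 by ring, Real.rpow_add hs0,
            Real.rpow_one]

theorem summable_mittagLeffler {α : ℝ} (hα : 0 < α) (hα1 : α < 1) (x : ℝ) :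
    Summable fun k : ℕ => x ^ k / Real.Gamma (α * k + α) := by
  rcases eq_or_ne x 0 with rfl | hx
  · refine summable_of_ne_finset_zero (s := {0}) fun k hk => ?_
    simp [zero_pow (by simpa using hk : k ≠ 0)]
  have hpos (k : ℕ) : 0 < α * k + α := by positivity
  have hG (k : ℕ) := Real.Gamma_pos_of_pos (hpos k)
  refine summable_of_ratio_test_tendsto_lt_one zero_lt_one
    (Eventually.of_forall fun k => div_ne_zero (pow_ne_zero _ hx) (hG k).ne') ?_
  have hlim : Tendsto (fun k : ℕ => α * (k : ℝ) + α) atTop atTop :=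
    tendsto_atTop_add_const_right _ _ (tendsto_natCast_atTop_atTop.const_mul_atTop hα)
  have h := ((tendsto_add_rpow_div hα hα1).comp hlim).const_mul |x|
  rw [mul_zero] at h
  refine squeeze_zero (fun k => by positivity) (fun k => ?_) h
  have e : α * ((k + 1 : ℕ) : ℝ) + α = (α * k + α) + α := by push_cast; ring
  have hG' := hG (k + 1)
  rw [e] at hG' ⊢
  simp only [norm_div, norm_pow, Real.norm_eq_abs, abs_of_pos (hG k), abs_of_pos hG',
    Function.comp]
  have hx' : 0 < |x| := abs_pos.2 hx
  calc |x| ^ (k + 1) / Real.Gamma (α * k + α + α) / (|x| ^ k / Real.Gamma (α * k + α))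
      = |x| * (Real.Gamma (α * k + α) / Real.Gamma (α * k + α + α)) := by
        have := hG k
        rw [pow_succ]
        field_simp
    _ ≤ _ := mul_le_mul_of_nonneg_left (Gamma_div_Gamma_add_le hα hα1 (hpos k)) hx'.le

theorem continuous_mittagLeffler {α : ℝ} (hα : 0 < α) (hα1 : α < 1) :
    Continuous (mittagLeffler α α) := by
  refine continuous_iff_continuousAt.2 fun x => ?_
  have hc : ContinuousOn (mittagLeffler α α) (Icc (-(|x| + 1)) (|x| + 1)) := by
    refine continuousOn_tsum (fun k => by fun_prop)
      (summable_mittagLeffler hα hα1 (|x| + 1)) fun k y hy => ?_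
    have hG : 0 < Real.Gamma (α * k + α) := Real.Gamma_pos_of_pos (by positivity)
    rw [norm_div, norm_pow, Real.norm_eq_abs, Real.norm_eq_abs, abs_of_pos hG]
    gcongr
    exact abs_le.2 hy
  refine hc.continuousAt (Icc_mem_nhds ?_ ?_)
  · linarith [neg_abs_le x]
  · linarith [le_abs_self x]

theorem mittagLeffler_zero (α β : ℝ) : mittagLeffler α β 0 = 1 / Real.Gamma β := by
  rw [mittagLeffler, tsum_eq_single 0 fun k hk => by simp [zero_pow hk]]
  simp

theorem continuous_mittagLeffler_neg_rpow {α : ℝ} (hα : 0 < α) (hα1 : α < 1) :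
    Continuous fun s : ℝ => mittagLeffler α α (-s ^ α) :=
  (continuous_mittagLeffler hα hα1).comp (Real.continuous_rpow_const hα.le).neg

theorem intervalIntegrable_kernel_mul_mittagLeffler {α t : ℝ} (hα : 0 < α) (hα1 : α < 1)
    (ht : 0 < t) :
    IntervalIntegrable
      (fun s => s ^ (α - 1) * (t - s) ^ (α - 1) * mittagLeffler α α (-s ^ α)) volume 0 t :=
  (intervalIntegrable_rpow_mul_sub_rpow hα hα ht).mul_continuousOn
    (continuous_mittagLeffler_neg_rpow hα hα1).continuousOn

/-- The Volterra equation satisfied by `t ↦ t ^ (α - 1) * E_{α,α}(-t ^ α)`. -/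
theorem integral_kernel_mul_mittagLeffler {α t : ℝ} (hα : 0 < α) (hα1 : α < 1) (ht : 0 < t) :
    ∫ s in (0 : ℝ)..t, s ^ (α - 1) * (t - s) ^ (α - 1) * mittagLeffler α α (-s ^ α) =
      t ^ (α - 1) - Real.Gamma α * (t ^ (α - 1) * mittagLeffler α α (-t ^ α)) := by
  have hG (k : ℕ) : 0 < Real.Gamma (α * k + α) := Real.Gamma_pos_of_pos (by positivity)
  have hGα : 0 < Real.Gamma α := Real.Gamma_pos_of_pos hα
  have hpos (k : ℕ) : 0 < α * k + α := by positivity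
  let f : ℕ → ℝ → ℝ := fun k s =>
    (-1) ^ k / Real.Gamma (α * k + α) * (s ^ (α * k + α - 1) * (t - s) ^ (α - 1))
  have hint (k : ℕ) : IntervalIntegrable (f k) volume 0 t :=
    (intervalIntegrable_rpow_mul_sub_rpow (hpos k) hα ht).const_mul _
  have hterm (k : ℕ) : t ^ (α * k + α + α - 1) *
      (Real.Gamma (α * k + α) * Real.Gamma α / Real.Gamma (α * k + α + α)) =
      Real.Gamma (α * k + α) * (Real.Gamma α * t ^ (α - 1) *
        ((t ^ α) ^ (k + 1) / Real.Gamma (α * (k + 1 : ℕ) + α))) := by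
    have e1 : α * ((k + 1 : ℕ) : ℝ) + α = α * k + α + α := by push_cast; ring
    have e2 : (t ^ α) ^ (k + 1) * t ^ (α - 1) = t ^ (α * k + α + α - 1) := by
      rw [← Real.rpow_natCast, ← Real.rpow_mul ht.le, ← Real.rpow_add ht]
      congr 1
      push_cast
      ring
    rw [e1, ← e2]
    ring
  have hval (k : ℕ) : ∫ s in (0 : ℝ)..t, f k s =
      -(Real.Gamma α * t ^ (α - 1)) *
        ((-t ^ α) ^ (k + 1) / Real.Gamma (α * (k + 1 : ℕ) + α)) := by
    rw [intervalIntegral.integral_const_mul, integral_rpow_mul_sub_rpow (hpos k) hα ht, hterm,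
      neg_pow (t ^ α), pow_succ (-1 : ℝ)]
    have := (hG k).ne'
    field_simp
  have hnorm (k : ℕ) : ∫ s in Ioc 0 t, ‖f k s‖ =
      Real.Gamma α * t ^ (α - 1) * ((t ^ α) ^ (k + 1) / Real.Gamma (α * (k + 1 : ℕ) + α)) := by
    have : ∫ s in Ioc 0 t, ‖f k s‖ = ∫ s in Ioc 0 t,
        1 / Real.Gamma (α * k + α) * (s ^ (α * k + α - 1) * (t - s) ^ (α - 1)) := by
      refine setIntegral_congr_fun measurableSet_Ioc fun s hs => ?_
      have h1 := Real.rpow_nonneg hs.1.le (α * k + α - 1)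
      have h2 := Real.rpow_nonneg (sub_nonneg.2 hs.2) (α - 1)
      simp only [f, norm_mul, norm_div, norm_pow, norm_neg, norm_one, one_pow, Real.norm_eq_abs,
        abs_of_pos (hG k), abs_of_nonneg h1, abs_of_nonneg h2]
    rw [this, ← intervalIntegral.integral_of_le ht.le, intervalIntegral.integral_const_mul,
      integral_rpow_mul_sub_rpow (hpos k) hα ht, hterm]
    have := (hG k).ne'
    field_simp
  have hsum := hasSum_integral_of_summable_integral_norm (μ := volume.restrict (Ioc 0 t))
    (F := f) (fun k => (intervalIntegrable_iff_integrableOn_Ioc_of_le ht.le).1 (hint k)) (by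
      simp_rw [hnorm]
      exact ((summable_nat_add_iff 1).2 (summable_mittagLeffler hα hα1 (t ^ α))).mul_left _)
  have hcongr : ∫ s in (0 : ℝ)..t, s ^ (α - 1) * (t - s) ^ (α - 1) * mittagLeffler α α (-s ^ α) =
      ∫ s in Ioc 0 t, ∑' k, f k s := by
    rw [intervalIntegral.integral_of_le ht.le]
    refine setIntegral_congr_fun measurableSet_Ioc fun s hs => ?_
    simp only [mittagLeffler]
    rw [← tsum_mul_left]
    refine tsum_congr fun k => ?_
    have e : s ^ (α * k + α - 1) = (s ^ α) ^ k * s ^ (α - 1) := by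
      rw [← Real.rpow_natCast, ← Real.rpow_mul hs.1.le, ← Real.rpow_add hs.1]
      congr 1
      ring
    simp only [f]
    rw [e, neg_pow (s ^ α)]
    ring
  have hE := (summable_mittagLeffler hα hα1 (-t ^ α)).tsum_eq_zero_add
  rw [hcongr, ← hsum.tsum_eq]
  simp_rw [← intervalIntegral.integral_of_le ht.le, hval]
  rw [tsum_mul_left, mittagLeffler, hE]
  simp only [pow_zero, Nat.cast_zero, mul_zero, zero_add]
  field_simp
  ring

/-- Consequence of the Volterra equation and of the log-convexity of the kernel: if the solution
is positive before time `t` and nonpositive at a later time `T`, then the values on `[t, T]`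
control the value at `t`. -/
theorem le_integral_kernel_mul_mittagLeffler {α t T : ℝ} (hα : 0 < α) (hα1 : α < 1) (ht : 0 < t)
    (htT : t < T) (hpos : ∀ s ∈ Ico 0 T, 0 < mittagLeffler α α (-s ^ α))
    (hT : mittagLeffler α α (-T ^ α) ≤ 0) :
    (T / t) ^ (α - 1) * (Real.Gamma α * (t ^ (α - 1) * mittagLeffler α α (-t ^ α))) ≤
      ∫ s in t..T, s ^ (α - 1) * (T - s) ^ (α - 1) * mittagLeffler α α (-s ^ α) := by
  have hT0 : 0 < T := ht.trans htT
  have hi := intervalIntegrable_kernel_mul_mittagLeffler hα hα1 hT0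
  have hi1 := hi.mono_set (c := 0) (d := t) (by
    rw [uIcc_of_le ht.le, uIcc_of_le hT0.le]; exact Icc_subset_Icc_right htT.le)
  have hi2 := hi.mono_set (c := t) (d := T) (by
    rw [uIcc_of_le htT.le, uIcc_of_le hT0.le]; exact Icc_subset_Icc_left ht.le)
  have hadd := intervalIntegral.integral_add_adjacent_intervals hi1 hi2
  rw [integral_kernel_mul_mittagLeffler hα hα1 hT0] at hadd
  have hle := intervalIntegral.integral_mono_on_of_le_Ioo ht.le hi1
    ((intervalIntegrable_kernel_mul_mittagLeffler hα hα1 ht).const_mul ((T / t) ^ (α - 1)))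
    fun s hs => by
      have hF := hpos s ⟨hs.1.le, hs.2.trans htT⟩
      have hs0 := hs.1
      have hts : 0 < t - s := sub_pos.2 hs.2
      have hk : (T - s) ^ (α - 1) ≤ (T / t) ^ (α - 1) * (t - s) ^ (α - 1) := by
        rw [← Real.mul_rpow (by positivity) hts.le]
        refine Real.rpow_le_rpow_of_nonpos (by positivity) ?_ (by linarith)
        rw [div_mul_eq_mul_div, div_le_iff₀ ht]
        nlinarith
      calc s ^ (α - 1) * (T - s) ^ (α - 1) * mittagLeffler α α (-s ^ α)
          ≤ s ^ (α - 1) * ((T / t) ^ (α - 1) * (t - s) ^ (α - 1)) *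
              mittagLeffler α α (-s ^ α) := by gcongr
        _ = _ := by ring
  rw [intervalIntegral.integral_const_mul, integral_kernel_mul_mittagLeffler hα hα1 ht, mul_sub,
    ← Real.mul_rpow (by positivity) ht.le, div_mul_cancel₀ _ ht.ne'] at hle
  have : Real.Gamma α * (T ^ (α - 1) * mittagLeffler α α (-T ^ α)) ≤ 0 :=
    mul_nonpos_of_nonneg_of_nonpos (Real.Gamma_pos_of_pos hα).le
      (mul_nonpos_of_nonneg_of_nonpos (by positivity) hT)
  linarith

/-- If `s ↦ E_{α,α}(-s ^ α)` is positive before time `T`, then it is positive at `T`. -/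
theorem mittagLeffler_neg_rpow_pos_of_pos_of_lt {α T : ℝ} (hα : 0 < α) (hα1 : α < 1) (hT0 : 0 < T)
    (hpos : ∀ s ∈ Ico 0 T, 0 < mittagLeffler α α (-s ^ α)) :
    0 < mittagLeffler α α (-T ^ α) := by
  by_contra! hT
  have hGα : 0 < Real.Gamma α := Real.Gamma_pos_of_pos hα
  have hlim : Tendsto (fun r : ℝ => (T - r) ^ α / α) (𝓝[<] T) (𝓝 0) := by
    have hc : Continuous fun r : ℝ => (T - r) ^ α / α :=
      ((Real.continuous_rpow_const hα.le).comp (continuous_const.sub continuous_id)).div_const _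
    have := (hc.tendsto T).mono_left (nhdsWithin_le_nhds (s := Iio T))
    simpa [Real.zero_rpow hα.ne'] using this
  obtain ⟨r, ⟨hr, hrlt⟩, hr2⟩ := ((hlim.eventually_lt_const
    (show 0 < 2 ^ (α - 1) * Real.Gamma α by positivity)).and self_mem_nhdsWithin |>.and
    ((eventually_gt_nhds (half_lt_self hT0)).filter_mono nhdsWithin_le_nhds)).exists
  replace hrlt : r < T := hrlt
  have hr0 : 0 < r := by linarith
  let y : ℝ → ℝ := fun s => s ^ (α - 1) * mittagLeffler α α (-s ^ α)
  have hy : ContinuousOn y (Icc r T) :=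
    (continuousOn_id.rpow_const fun s hs => Or.inl (hr0.trans_le hs.1).ne').mul
      (continuous_mittagLeffler_neg_rpow hα hα1).continuousOn
  obtain ⟨t, ht, hmax⟩ := isCompact_Icc.exists_isMaxOn (nonempty_Icc.2 hrlt.le) hy
  have hyt : 0 < y t :=
    (mul_pos (by positivity) (hpos r ⟨hr0.le, hrlt⟩)).trans_le (hmax (left_mem_Icc.2 hrlt.le))
  have ht0 : 0 < t := hr0.trans_le ht.1
  have htT : t < T := by
    refine lt_of_le_of_ne ht.2 ?_
    rintro rfl
    exact hyt.not_ge (mul_nonpos_of_nonneg_of_nonpos (by positivity) hT)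
  have hkey := le_integral_kernel_mul_mittagLeffler hα hα1 ht0 htT hpos hT
  have hi := (intervalIntegrable_kernel_mul_mittagLeffler hα hα1 hT0).mono_set (c := t) (d := T) (by
    rw [uIcc_of_le htT.le, uIcc_of_le hT0.le]; exact Icc_subset_Icc_left ht0.le)
  have hker : IntervalIntegrable (fun s => (T - s) ^ (α - 1)) volume t T := by
    have := (intervalIntegral.intervalIntegrable_rpow' (a := 0) (b := T - t)
      (show -1 < α - 1 by linarith)).comp_sub_left T
    simpa using this.symm
  have hkerval : ∫ s in t..T, (T - s) ^ (α - 1) = (T - t) ^ α / α := by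
    rw [intervalIntegral.integral_comp_sub_left (fun s => s ^ (α - 1)), sub_self,
      integral_rpow (Or.inl (by linarith)), sub_add_cancel, Real.zero_rpow hα.ne', sub_zero]
  have hle := intervalIntegral.integral_mono_on htT.le hi (hker.const_mul (y t)) fun s hs => by
    have h1 : y s ≤ y t := hmax ⟨ht.1.trans hs.1, hs.2⟩
    have h2 := Real.rpow_nonneg (sub_nonneg.2 hs.2) (α - 1)
    calc s ^ (α - 1) * (T - s) ^ (α - 1) * mittagLeffler α α (-s ^ α)
        = y s * (T - s) ^ (α - 1) := by simp only [y]; ring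
      _ ≤ y t * (T - s) ^ (α - 1) := by gcongr
  rw [intervalIntegral.integral_const_mul, hkerval] at hle
  have h2 : (2 : ℝ) ^ (α - 1) ≤ (T / t) ^ (α - 1) := by
    refine Real.rpow_le_rpow_of_nonpos (by positivity) ?_ (by linarith)
    rw [div_le_iff₀ ht0]
    linarith [ht.1]
  have h3 : (T - t) ^ α / α ≤ (T - r) ^ α / α := by
    have : 0 ≤ T - t := by linarith
    gcongr
    exact ht.1
  have h4 : y t * ((T - t) ^ α / α) < y t * (2 ^ (α - 1) * Real.Gamma α) := by
    gcongr
    exact h3.trans_lt hr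
  have h5 : 2 ^ (α - 1) * (Real.Gamma α * y t) ≤ (T / t) ^ (α - 1) * (Real.Gamma α * y t) := by
    gcongr
  simp only [y] at *
  linarith

/-- For every real `α` with `0 < α < 1` and every real `x ≥ 0`,
the value `E_{α,α}(-x)` is strictly positive. -/
theorem mittagLeffler_two_param_neg_pos (α : ℝ) (hα : 0 < α) (hα1 : α < 1)
    (x : ℝ) (hx : 0 ≤ x) :
    0 < mittagLeffler α α (-x) := by
  by_contra! hneg
  let S : Set ℝ := Ici 0 ∩ {t | mittagLeffler α α (-t ^ α) ≤ 0}
  have hS : IsClosed S := isClosed_Ici.inter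
    (isClosed_le (continuous_mittagLeffler_neg_rpow hα hα1) continuous_const)
  have hne : S.Nonempty := by
    refine ⟨x ^ α⁻¹, Real.rpow_nonneg hx _, ?_⟩
    rwa [mem_ofPred_eq, Real.rpow_inv_rpow hx hα.ne']
  have hbdd : BddBelow S := ⟨0, fun t ht => ht.1⟩
  have hmem := hS.csInf_mem hne hbdd
  have hT0 : 0 < sInf S := by
    refine lt_of_le_of_ne hmem.1 fun h => ?_
    have h2 := hmem.2
    rw [mem_ofPred_eq, ← h, Real.zero_rpow hα.ne', neg_zero, mittagLeffler_zero] at h2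
    exact h2.not_gt (one_div_pos.2 (Real.Gamma_pos_of_pos hα))
  refine hmem.2.not_gt (mittagLeffler_neg_rpow_pos_of_pos_of_lt hα hα1 hT0 fun s hs => ?_)
  by_contra! h
  exact hs.2.not_ge (csInf_le hbdd ⟨hs.1, h⟩)
end
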